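/- arXiv:2406.07523 — 6 statements merged into one kernel-verified Lean document; each statement's English description precedes it below -/
import Mathlib

section
/- For every Borel probability measure π on (0,∞)² with ∫ x₁ dπ(x₀,x₁) < ∞, the measure S(π) is a Borel probability measure on (0,∞)² with ∫ y₁ dS(π)(y₀,y₁) < ∞, and S(S(π)) = π. -/
open MeasureTheory Set

/-- Barycenter of a measure on `ℝ`. -/
noncomputable def bary (mu : Measure ℝ) : ℝ := ∫ x, x ∂mu

/-- `mu ∈ P₁((0,∞))`: Borel probability measure on `ℝ` concentrated on `(0,∞)`
with finite first moment. -/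
def MemP1 (mu : Measure ℝ) : Prop :=
  IsProbabilityMeasure mu ∧ mu (Set.Ioi (0:ℝ))ᶜ = 0 ∧ Integrable id mu

/-- Change-of-numeraire transform of a measure on `ℝ`:
`S(mu)(B) = (1/b(mu)) ∫ x · 1_B(1/x) dmu(x)`. -/
noncomputable def S (mu : Measure ℝ) : Measure ℝ :=
  (ENNReal.ofReal (bary mu))⁻¹ •
    ((mu.withDensity fun x => ENNReal.ofReal x).map fun x => x⁻¹)

/-- Change-of-numeraire transform of a measure on `ℝ × ℝ`:
`S(π)(B) = (∫ x₁ · 1_B(1/x₀,1/x₁) dπ) / (∫ x₁ dπ)`. -/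
noncomputable def S2 (pi : Measure (ℝ × ℝ)) : Measure (ℝ × ℝ) :=
  (ENNReal.ofReal (∫ p, p.2 ∂pi))⁻¹ •
    ((pi.withDensity fun p => ENNReal.ofReal p.2).map fun p => (p.1⁻¹, p.2⁻¹))

/-- Integration against the change-of-numeraire transform. -/
theorem lintegral_S2 (mu : Measure (ℝ × ℝ)) {f : ℝ × ℝ → ENNReal} (hf : Measurable f) :
    ∫⁻ q, f q ∂(S2 mu) = (ENNReal.ofReal (∫ p, p.2 ∂mu))⁻¹ *
      ∫⁻ p, ENNReal.ofReal p.2 * f (p.1⁻¹, p.2⁻¹) ∂mu := by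
  have hinv : Measurable fun p : ℝ × ℝ => (p.1⁻¹, p.2⁻¹) := by fun_prop
  rw [S2, lintegral_smul_measure, lintegral_map hf hinv,
    lintegral_withDensity_eq_lintegral_mul mu (by fun_prop)
      (g := fun p : ℝ × ℝ => f (p.1⁻¹, p.2⁻¹)) (hf.comp hinv), smul_eq_mul]
  rfl

theorem ofReal_mul_ofReal_inv {x : ℝ} (hx : 0 < x) :
    ENNReal.ofReal x * ENNReal.ofReal x⁻¹ = 1 := by
  rw [← ENNReal.ofReal_mul hx.le, mul_inv_cancel₀ hx.ne', ENNReal.ofReal_one]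

/-- `S` preserves probability measures on `(0,∞)²` with integrable second
coordinate, and is an involution on them. -/
theorem stmt2 (pi : Measure (ℝ × ℝ)) (hp : IsProbabilityMeasure pi)
    (hconc : pi ((Set.Ioi (0:ℝ) ×ˢ Set.Ioi (0:ℝ))ᶜ) = 0)
    (hint : Integrable (fun p => p.2) pi) :
    IsProbabilityMeasure (S2 pi) ∧
    S2 pi ((Set.Ioi (0:ℝ) ×ˢ Set.Ioi (0:ℝ))ᶜ) = 0 ∧
    Integrable (fun p => p.2) (S2 pi) ∧
    S2 (S2 pi) = pi := by
  have hquad : MeasurableSet ((Ioi (0:ℝ) ×ˢ Ioi (0:ℝ))ᶜ) :=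
    (measurableSet_Ioi.prod measurableSet_Ioi).compl
  have hpos : ∀ᵐ p ∂pi, p ∈ Ioi (0:ℝ) ×ˢ Ioi (0:ℝ) := hconc
  have hmean : ENNReal.ofReal (∫ p, p.2 ∂pi) = ∫⁻ p, ENNReal.ofReal p.2 ∂pi :=
    ofReal_integral_eq_lintegral_ofReal hint (hpos.mono fun p hp => le_of_lt hp.2)
  have hmean_ne_zero : ENNReal.ofReal (∫ p, p.2 ∂pi) ≠ 0 := by
    rw [hmean, Ne, lintegral_eq_zero_iff (by fun_prop)]
    intro h
    obtain ⟨p, hp0, hp⟩ := (h.and hpos).exists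
    exact (ENNReal.ofReal_pos.2 hp.2).ne' hp0
  have hmean_ne_top : ENNReal.ofReal (∫ p, p.2 ∂pi) ≠ ⊤ := ENNReal.ofReal_ne_top
  have hprob : IsProbabilityMeasure (S2 pi) := by
    constructor
    rw [← lintegral_one, lintegral_S2 pi measurable_const]
    simp only [mul_one]
    rw [← hmean, ENNReal.inv_mul_cancel hmean_ne_zero hmean_ne_top]
  have hconc' : S2 pi ((Ioi (0:ℝ) ×ˢ Ioi (0:ℝ))ᶜ) = 0 := by
    rw [← lintegral_indicator_one hquad,
      lintegral_S2 pi (measurable_one.indicator hquad)]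
    refine mul_eq_zero_of_right _ ((lintegral_congr_ae ?_).trans lintegral_zero)
    filter_upwards [hpos] with p hp
    rw [indicator_of_notMem, mul_zero]
    exact fun h => h ⟨mem_Ioi.2 (inv_pos.2 hp.1), mem_Ioi.2 (inv_pos.2 hp.2)⟩
  have hpos' : ∀ᵐ p ∂(S2 pi), p ∈ Ioi (0:ℝ) ×ˢ Ioi (0:ℝ) := hconc'
  have hnonneg' : 0 ≤ᵐ[S2 pi] fun p => p.2 := hpos'.mono fun p hp => le_of_lt hp.2
  have hmean' : ∫⁻ q, ENNReal.ofReal q.2 ∂(S2 pi) = (ENNReal.ofReal (∫ p, p.2 ∂pi))⁻¹ := by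
    rw [lintegral_S2 pi (by fun_prop),
      lintegral_congr_ae (hpos.mono fun p hp => ofReal_mul_ofReal_inv hp.2)]
    simp
  have hint' : Integrable (fun p => p.2) (S2 pi) := by
    refine ⟨by fun_prop, ?_⟩
    rw [hasFiniteIntegral_iff_ofReal hnonneg', hmean']
    exact ENNReal.inv_lt_top.2 hmean_ne_zero.bot_lt
  refine ⟨hprob, hconc', hint', Measure.ext_of_lintegral _ fun f hf => ?_⟩
  rw [lintegral_S2 _ hf, ofReal_integral_eq_lintegral_ofReal hint' hnonneg', hmean', inv_inv,
    lintegral_S2 pi (by fun_prop), ← mul_assoc,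
    ENNReal.mul_inv_cancel hmean_ne_zero hmean_ne_top, one_mul]
  refine lintegral_congr_ae ?_
  filter_upwards [hpos] with p hp
  rw [← mul_assoc, ofReal_mul_ofReal_inv hp.2, one_mul, inv_inv, inv_inv]
end

section
/- Let μ, ν ∈ P₁((0,∞)) and let π ∈ M(μ,ν) be a martingale coupling. Then the first marginal of S(π) equals S(μ). -/
open MeasureTheory Set

/-- `π ∈ M(μ,ν)`: martingale coupling of `μ` and `ν`, i.e. a probability measure on
`(0,∞)²` with first marginal `μ`, second marginal `ν`, such that
`∫ f(x₀)(x₁ - x₀) dπ = 0` for all bounded Borel `f`. -/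
def IsMC (mu nu : Measure ℝ) (pi : Measure (ℝ × ℝ)) : Prop :=
  IsProbabilityMeasure pi ∧
  pi ((Set.Ioi (0:ℝ) ×ˢ Set.Ioi (0:ℝ))ᶜ) = 0 ∧
  pi.map Prod.fst = mu ∧ pi.map Prod.snd = nu ∧
  ∀ f : ℝ → ℝ, Measurable f → (∃ M, ∀ x, |f x| ≤ M) →
    ∫ p, f p.1 * (p.2 - p.1) ∂pi = 0

theorem IsMC.integrable_fst {mu nu : Measure ℝ} {pi : Measure (ℝ × ℝ)}
    (hmu : MemP1 mu) (hpi : IsMC mu nu pi) : Integrable (fun p : ℝ × ℝ => p.1) pi := by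
  have h := hmu.2.2
  rw [← hpi.2.2.1] at h
  exact h.comp_measurable measurable_fst

theorem IsMC.integrable_snd {mu nu : Measure ℝ} {pi : Measure (ℝ × ℝ)}
    (hnu : MemP1 nu) (hpi : IsMC mu nu pi) : Integrable (fun p : ℝ × ℝ => p.2) pi := by
  have h := hnu.2.2
  rw [← hpi.2.2.2.1] at h
  exact h.comp_measurable measurable_snd

theorem IsMC.ae_pos {mu nu : Measure ℝ} {pi : Measure (ℝ × ℝ)} (hpi : IsMC mu nu pi) :
    ∀ᵐ p ∂pi, 0 < p.1 ∧ 0 < p.2 := by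
  have h : ∀ᵐ p ∂pi, p ∈ Set.Ioi (0:ℝ) ×ˢ Set.Ioi (0:ℝ) := mem_ae_iff.2 hpi.2.1
  filter_upwards [h] with p hp using hp

/-- Testing the martingale property against an indicator function. -/
theorem IsMC.setIntegral_snd_eq {mu nu : Measure ℝ} {pi : Measure (ℝ × ℝ)}
    (hmu : MemP1 mu) (hnu : MemP1 nu) (hpi : IsMC mu nu pi) {A : Set ℝ}
    (hA : MeasurableSet A) :
    ∫ p in Prod.fst ⁻¹' A, p.2 ∂pi = ∫ p in Prod.fst ⁻¹' A, p.1 ∂pi := by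
  have h := hpi.2.2.2.2 (A.indicator fun _ => 1) (measurable_const.indicator hA)
    ⟨1, fun x => by by_cases hx : x ∈ A <;> simp [hx]⟩
  have heq : (fun p : ℝ × ℝ => A.indicator (fun _ => (1:ℝ)) p.1 * (p.2 - p.1)) =
      (Prod.fst ⁻¹' A).indicator fun p => p.2 - p.1 := by
    ext p
    by_cases hp : p.1 ∈ A <;> simp [Set.indicator, hp]
  rw [heq, integral_indicator (measurable_fst hA),
    integral_sub (hpi.integrable_snd hnu).integrableOn (hpi.integrable_fst hmu).integrableOn] at h
  exact sub_eq_zero.1 h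

theorem IsMC.map_fst_withDensity_snd {mu nu : Measure ℝ} {pi : Measure (ℝ × ℝ)}
    (hmu : MemP1 mu) (hnu : MemP1 nu) (hpi : IsMC mu nu pi) :
    (pi.withDensity fun p => ENNReal.ofReal p.2).map Prod.fst =
      mu.withDensity fun x => ENNReal.ofReal x := by
  ext A hA
  rw [Measure.map_apply measurable_fst hA, withDensity_apply _ (measurable_fst hA),
    withDensity_apply _ hA, ← hpi.2.2.1,
    setLIntegral_map hA ENNReal.measurable_ofReal measurable_fst,
    ← ofReal_integral_eq_lintegral_ofReal (hpi.integrable_snd hnu).integrableOn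
      (ae_restrict_of_ae (hpi.ae_pos.mono fun p hp => hp.2.le)),
    ← ofReal_integral_eq_lintegral_ofReal (hpi.integrable_fst hmu).integrableOn
      (ae_restrict_of_ae (hpi.ae_pos.mono fun p hp => hp.1.le)),
    hpi.setIntegral_snd_eq hmu hnu hA]

theorem IsMC.integral_snd_eq_bary {mu nu : Measure ℝ} {pi : Measure (ℝ × ℝ)}
    (hmu : MemP1 mu) (hnu : MemP1 nu) (hpi : IsMC mu nu pi) :
    ∫ p, p.2 ∂pi = bary mu := by
  have h := hpi.setIntegral_snd_eq hmu hnu MeasurableSet.univ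
  simp only [Set.preimage_univ, Measure.restrict_univ] at h
  rw [h, bary, ← hpi.2.2.1]
  exact (integral_map measurable_fst.aemeasurable measurable_id.aestronglyMeasurable).symm

/-- for a martingale coupling `π ∈ M(μ,ν)`, the first marginal of `S(π)`
equals `S(μ)`. -/
theorem stmt4 (mu nu : Measure ℝ) (hmu : MemP1 mu) (hnu : MemP1 nu)
    (pi : Measure (ℝ × ℝ)) (hpi : IsMC mu nu pi) :
    (S2 pi).map Prod.fst = S mu := by
  rw [S2, S, Measure.map_smul, hpi.integral_snd_eq_bary hmu hnu,
    ← hpi.map_fst_withDensity_snd hmu hnu, Measure.map_map measurable_fst (by fun_prop),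
    Measure.map_map measurable_inv measurable_fst]
  rfl
end

section
/- For μ, ν ∈ P₁((0,∞)), the map π ↦ S(π) is a bijection from M(μ,ν) onto M(S(μ),S(ν)): if π ∈ M(μ,ν) then S(π) ∈ M(S(μ),S(ν)), the map is injective on M(μ,ν), and every element of M(S(μ),S(ν)) is of the form S(π) for some π ∈ M(μ,ν). -/
open MeasureTheory Set

/-- Reweight `m` by the normalized density `w`, then push forward along `i`. -/
noncomputable def reweightMap {α : Type*} [MeasurableSpace α] (w : α → ℝ) (i : α → α)
    (m : Measure α) : Measure α :=
  (ENNReal.ofReal (∫ a, w a ∂m))⁻¹ • ((m.withDensity fun a => ENNReal.ofReal (w a)).map i)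

/-- `w` is an almost surely positive, integrable weight for the probability measure `m`. -/
structure IsPosWeight {α : Type*} [MeasurableSpace α] (w : α → ℝ) (m : Measure α) : Prop where
  prob : IsProbabilityMeasure m
  pos : ∀ᵐ a ∂m, 0 < w a
  integrable : Integrable w m

theorem lintegral_withDensity_ofReal_mul {α : Type*} [MeasurableSpace α] {w : α → ℝ}
    (hw : Measurable w) (m : Measure α) {G : α → ENNReal} (hG : Measurable G) :
    ∫⁻ a, G a ∂(m.withDensity fun a => ENNReal.ofReal (w a)) =
      ∫⁻ a, ENNReal.ofReal (w a) * G a ∂m :=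
  lintegral_withDensity_eq_lintegral_mul _ hw.ennreal_ofReal hG

theorem lintegral_reweightMap {α : Type*} [MeasurableSpace α] {w : α → ℝ} {i : α → α}
    (hw : Measurable w) (hi : Measurable i) (m : Measure α) {F : α → ENNReal}
    (hF : Measurable F) :
    ∫⁻ a, F a ∂(reweightMap w i m) =
      (ENNReal.ofReal (∫ a, w a ∂m))⁻¹ * ∫⁻ a, ENNReal.ofReal (w a) * F (i a) ∂m := by
  rw [reweightMap, lintegral_smul_measure, lintegral_map hF hi,
    lintegral_withDensity_ofReal_mul hw m (by fun_prop), smul_eq_mul]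

theorem IsPosWeight.lintegral {α : Type*} [MeasurableSpace α] {w : α → ℝ} {m : Measure α}
    (h : IsPosWeight w m) :
    ∫⁻ a, ENNReal.ofReal (w a) ∂m = ENNReal.ofReal (∫ a, w a ∂m) :=
  (ofReal_integral_eq_lintegral_ofReal h.integrable (h.pos.mono fun _ ha => ha.le)).symm

theorem IsPosWeight.integral_pos {α : Type*} [MeasurableSpace α] {w : α → ℝ} {m : Measure α}
    (h : IsPosWeight w m) : 0 < ∫ a, w a ∂m := by
  have := h.prob
  rw [integral_pos_iff_support_of_nonneg_ae (h.pos.mono fun _ ha => ha.le) h.integrable]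
  have h1 : m (Function.support w) = 1 :=
    prob_compl_eq_zero_iff₀ (h.integrable.1.nullMeasurableSet_support) |>.1
      (measure_mono_null (fun a ha h0 => ha (ne_of_gt h0)) h.pos)
  simp [h1]

theorem IsPosWeight.ae_reweightMap {α : Type*} [MeasurableSpace α] {w : α → ℝ} {i : α → α}
    {m : Measure α} (hi : Measurable i) {p : α → Prop} (hp : MeasurableSet {a | p a})
    (h : ∀ᵐ a ∂m, p (i a)) : ∀ᵐ a ∂(reweightMap w i m), p a :=
  Measure.ae_smul_measure ((ae_map_iff hi.aemeasurable hp).2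
    ((withDensity_absolutelyContinuous m _).ae_le h)) _

theorem IsPosWeight.lintegral_weight_mul {α : Type*} [MeasurableSpace α] {w : α → ℝ}
    {m : Measure α} (h : IsPosWeight w m) (F : α → ENNReal) :
    ∫⁻ a, ENNReal.ofReal (w a) * (ENNReal.ofReal (w a)⁻¹ * F a) ∂m = ∫⁻ a, F a ∂m := by
  refine lintegral_congr_ae (h.pos.mono fun a ha => ?_)
  dsimp only
  rw [← mul_assoc, ← ENNReal.ofReal_mul ha.le, mul_inv_cancel₀ ha.ne', ENNReal.ofReal_one, one_mul]

theorem IsPosWeight.lintegral_weight_reweightMap {α : Type*} [MeasurableSpace α] {w : α → ℝ}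
    {i : α → α} {m : Measure α} (hw : Measurable w) (hi : Measurable i)
    (hwi : ∀ a, w (i a) = (w a)⁻¹) (h : IsPosWeight w m) :
    ∫⁻ a, ENNReal.ofReal (w a) ∂(reweightMap w i m) = (ENNReal.ofReal (∫ a, w a ∂m))⁻¹ := by
  have := h.prob
  rw [lintegral_reweightMap hw hi m hw.ennreal_ofReal]
  have := h.lintegral_weight_mul 1
  simp only [Pi.one_apply, mul_one, lintegral_one, measure_univ] at this
  simp [hwi, this]

theorem IsPosWeight.reweightMap {α : Type*} [MeasurableSpace α] {w : α → ℝ} {i : α → α}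
    {m : Measure α} (hw : Measurable w) (hi : Measurable i)
    (hwi : ∀ a, w (i a) = (w a)⁻¹) (h : IsPosWeight w m) :
    IsPosWeight w (reweightMap w i m) := by
  have hc := h.integral_pos
  have hpos : ∀ᵐ a ∂(_root_.reweightMap w i m), 0 < w a :=
    ae_reweightMap hi (measurableSet_lt measurable_const hw)
      (h.pos.mono fun a ha => by rw [hwi]; positivity)
  refine ⟨⟨?_⟩, hpos, hw.aestronglyMeasurable, ?_⟩
  · rw [← lintegral_one]
    refine (lintegral_reweightMap hw hi m measurable_const).trans ?_
    simp only [mul_one, h.lintegral]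
    exact ENNReal.inv_mul_cancel (by simpa using hc) ENNReal.ofReal_ne_top
  · rw [hasFiniteIntegral_iff_ofReal (hpos.mono fun _ ha => ha.le),
      h.lintegral_weight_reweightMap hw hi hwi]
    simpa using hc

theorem IsPosWeight.reweightMap_reweightMap {α : Type*} [MeasurableSpace α] {w : α → ℝ}
    {i : α → α} {m : Measure α} (hw : Measurable w) (hi : Measurable i)
    (hii : Function.Involutive i) (hwi : ∀ a, w (i a) = (w a)⁻¹) (h : IsPosWeight w m) :
    _root_.reweightMap w i (_root_.reweightMap w i m) = m := by
  have hc := h.integral_pos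
  refine Measure.ext_of_lintegral _ fun F hF => ?_
  rw [lintegral_reweightMap hw hi _ hF,
    lintegral_reweightMap hw hi m (by fun_prop),
    ← (h.reweightMap hw hi hwi).lintegral, h.lintegral_weight_reweightMap hw hi hwi]
  simp only [hwi, hii _]
  rw [h.lintegral_weight_mul, inv_inv, ← mul_assoc,
    ENNReal.mul_inv_cancel (by simpa using hc) ENNReal.ofReal_ne_top, one_mul]

theorem S_eq_reweightMap (mu : Measure ℝ) : S mu = reweightMap (fun x => x) (fun x => x⁻¹) mu :=
  rfl

theorem S2_eq_reweightMap (pi : Measure (ℝ × ℝ)) :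
    S2 pi = reweightMap Prod.snd (fun p => (p.1⁻¹, p.2⁻¹)) pi :=
  rfl

theorem measurable_inv_prod : Measurable fun p : ℝ × ℝ => (p.1⁻¹, p.2⁻¹) := by fun_prop

theorem memP1_iff (mu : Measure ℝ) : MemP1 mu ↔ IsPosWeight (fun x => x) mu :=
  ⟨fun h => ⟨h.1, h.2.1, h.2.2⟩, fun h => ⟨h.prob, h.pos, h.integrable⟩⟩

theorem MemP1.S {mu : Measure ℝ} (h : MemP1 mu) : MemP1 (S mu) :=
  (memP1_iff _).2 (((memP1_iff _).1 h).reweightMap measurable_id measurable_inv fun _ => rfl)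

theorem MemP1.S_S {mu : Measure ℝ} (h : MemP1 mu) : _root_.S (_root_.S mu) = mu :=
  ((memP1_iff _).1 h).reweightMap_reweightMap measurable_id measurable_inv inv_inv fun _ => rfl

/-- The martingale condition as an identity between lower Lebesgue integrals. -/
theorem lintegral_eq_of_martingale {pi : Measure (ℝ × ℝ)}
    (h1 : IsPosWeight Prod.fst pi) (h2 : IsPosWeight Prod.snd pi)
    (h : ∀ f : ℝ → ℝ, Measurable f → (∃ M, ∀ x, |f x| ≤ M) →
      ∫ p, f p.1 * (p.2 - p.1) ∂pi = 0) {g : ℝ → ENNReal} (hg : Measurable g) :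
    ∫⁻ p, ENNReal.ofReal p.2 * g p.1 ∂pi = ∫⁻ p, ENNReal.ofReal p.1 * g p.1 ∂pi := by
  have key : (pi.withDensity fun p => ENNReal.ofReal p.2).map Prod.fst =
      (pi.withDensity fun p => ENNReal.ofReal p.1).map Prod.fst := by
    ext B hB
    have hB' : MeasurableSet (Prod.fst ⁻¹' B : Set (ℝ × ℝ)) := measurable_fst hB
    rw [Measure.map_apply measurable_fst hB, Measure.map_apply measurable_fst hB,
      withDensity_apply _ hB', withDensity_apply _ hB',
      ← ofReal_integral_eq_lintegral_ofReal h2.integrable.integrableOn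
        (ae_restrict_of_ae (h2.pos.mono fun _ ha => ha.le)),
      ← ofReal_integral_eq_lintegral_ofReal h1.integrable.integrableOn
        (ae_restrict_of_ae (h1.pos.mono fun _ ha => ha.le))]
    congr 1
    rw [← sub_eq_zero, ← integral_sub h2.integrable.integrableOn h1.integrable.integrableOn,
      ← integral_indicator hB', ← h (B.indicator 1) (measurable_one.indicator hB)
        ⟨1, fun x => by by_cases hx : x ∈ B <;> simp [hx]⟩]
    congr 1 with p
    by_cases hp : p.1 ∈ B <;> simp [hp]
  have := congrArg (fun m => ∫⁻ x, g x ∂m) key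
  rwa [lintegral_map hg measurable_fst, lintegral_map hg measurable_fst,
    lintegral_withDensity_ofReal_mul measurable_snd _ (by fun_prop),
    lintegral_withDensity_ofReal_mul measurable_fst _ (by fun_prop)] at this

theorem martingale_of_lintegral_eq {pi : Measure (ℝ × ℝ)}
    (h1 : IsPosWeight Prod.fst pi) (h2 : IsPosWeight Prod.snd pi)
    (h : ∀ g : ℝ → ENNReal, Measurable g →
      ∫⁻ p, ENNReal.ofReal p.2 * g p.1 ∂pi = ∫⁻ p, ENNReal.ofReal p.1 * g p.1 ∂pi)
    {f : ℝ → ℝ} (hf : Measurable f) (hb : ∃ M, ∀ x, |f x| ≤ M) :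
    ∫ p, f p.1 * (p.2 - p.1) ∂pi = 0 := by
  have key : (pi.withDensity fun p => ENNReal.ofReal p.2).map Prod.fst =
      (pi.withDensity fun p => ENNReal.ofReal p.1).map Prod.fst := by
    refine Measure.ext_of_lintegral _ fun g hg => ?_
    rw [lintegral_map hg measurable_fst, lintegral_map hg measurable_fst,
      lintegral_withDensity_ofReal_mul measurable_snd _ (by fun_prop),
      lintegral_withDensity_ofReal_mul measurable_fst _ (by fun_prop)]
    exact h g hg
  have aux : ∀ w : ℝ × ℝ → ℝ, Measurable w → IsPosWeight w pi →
      ∫ x, f x ∂((pi.withDensity fun p => ENNReal.ofReal (w p)).map Prod.fst) =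
        ∫ p, f p.1 * w p ∂pi := by
    intro w hw hwp
    rw [integral_map measurable_fst.aemeasurable hf.aestronglyMeasurable,
      integral_withDensity_eq_integral_toReal_smul hw.ennreal_ofReal (by simp)]
    refine integral_congr_ae (hwp.pos.mono fun p hp => ?_)
    simp [ENNReal.toReal_ofReal hp.le, mul_comm]
  obtain ⟨M, hM⟩ := hb
  have hint : ∀ w : ℝ × ℝ → ℝ, Integrable w pi → Integrable (fun p => f p.1 * w p) pi :=
    fun w hw => hw.bdd_mul (hf.comp measurable_fst).aestronglyMeasurable
      (Filter.Eventually.of_forall fun p => hM p.1)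
  simp only [mul_sub]
  rw [integral_sub (hint _ h2.integrable) (hint _ h1.integrable),
    ← aux _ measurable_snd h2, ← aux _ measurable_fst h1, key, sub_self]

theorem IsMC.isPosWeight_fst {mu nu : Measure ℝ} {pi : Measure (ℝ × ℝ)} (hmu : MemP1 mu)
    (h : IsMC mu nu pi) : IsPosWeight Prod.fst pi := by
  obtain ⟨hp, hs, rfl, -, -⟩ := h
  exact ⟨hp, (show ∀ᵐ p ∂pi, p ∈ Ioi (0:ℝ) ×ˢ Ioi (0:ℝ) from hs).mono fun p hp => hp.1,
    hmu.2.2.comp_measurable measurable_fst⟩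

theorem IsMC.isPosWeight_snd {mu nu : Measure ℝ} {pi : Measure (ℝ × ℝ)} (hnu : MemP1 nu)
    (h : IsMC mu nu pi) : IsPosWeight Prod.snd pi := by
  obtain ⟨hp, hs, -, rfl, -⟩ := h
  exact ⟨hp, (show ∀ᵐ p ∂pi, p ∈ Ioi (0:ℝ) ×ˢ Ioi (0:ℝ) from hs).mono fun p hp => hp.2,
    hnu.2.2.comp_measurable measurable_snd⟩

theorem IsMC.S2_S2 {mu nu : Measure ℝ} {pi : Measure (ℝ × ℝ)} (hnu : MemP1 nu)
    (h : IsMC mu nu pi) : S2 (S2 pi) = pi :=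
  (h.isPosWeight_snd hnu).reweightMap_reweightMap measurable_snd measurable_inv_prod
    (fun p => by simp) fun _ => rfl

theorem IsMC.S2 {mu nu : Measure ℝ} {pi : Measure (ℝ × ℝ)} (hmu : MemP1 mu) (hnu : MemP1 nu)
    (h : IsMC mu nu pi) : IsMC (S mu) (S nu) (S2 pi) := by
  have h1 := h.isPosWeight_fst hmu
  have h2 := h.isPosWeight_snd hnu
  obtain ⟨-, hs, hfst, hsnd, hM⟩ := h
  have hmart := fun {g : ℝ → ENNReal} => lintegral_eq_of_martingale h1 h2 hM (g := g)
  have hS := h2.reweightMap measurable_snd measurable_inv_prod fun _ => rfl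
  rw [← S2_eq_reweightMap] at hS
  have hcnu : ∫ p, p.2 ∂pi = ∫ x, x ∂nu := by
    rw [← hsnd, integral_map measurable_snd.aemeasurable (by fun_prop)]
  have hcmu : ∫ p, p.2 ∂pi = ∫ x, x ∂mu := by
    rw [← hfst, integral_map measurable_fst.aemeasurable (by fun_prop),
      ← sub_eq_zero, ← integral_sub h2.integrable h1.integrable]
    simpa using hM (fun _ => 1) measurable_const ⟨1, by simp⟩
  have hS_fst : (_root_.S2 pi).map Prod.fst = S mu := by
    refine Measure.ext_of_lintegral _ fun F hF => ?_
    rw [lintegral_map hF measurable_fst, S2_eq_reweightMap, S_eq_reweightMap,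
      lintegral_reweightMap measurable_snd measurable_inv_prod _ (by fun_prop),
      lintegral_reweightMap (by fun_prop) (by fun_prop) _ hF, hcmu]
    congr 1
    refine (hmart (hF.comp measurable_inv)).trans ?_
    rw [← hfst, lintegral_map (by fun_prop) measurable_fst]
    rfl
  have hS_snd : (_root_.S2 pi).map Prod.snd = S nu := by
    refine Measure.ext_of_lintegral _ fun F hF => ?_
    rw [lintegral_map hF measurable_snd, S2_eq_reweightMap, S_eq_reweightMap,
      lintegral_reweightMap measurable_snd measurable_inv_prod _ (by fun_prop),
      lintegral_reweightMap (by fun_prop) (by fun_prop) _ hF, hcnu]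
    congr 1
    rw [← hsnd, lintegral_map (by fun_prop) measurable_snd]
  have hsupp : ∀ᵐ p ∂(_root_.S2 pi), p ∈ Set.Ioi (0:ℝ) ×ˢ Set.Ioi (0:ℝ) :=
    IsPosWeight.ae_reweightMap measurable_inv_prod (measurableSet_Ioi.prod measurableSet_Ioi)
      (by filter_upwards [h1.pos, h2.pos] with p hp hq using ⟨inv_pos.2 hp, inv_pos.2 hq⟩)
  have hS1 : IsPosWeight Prod.fst (_root_.S2 pi) :=
    ⟨hS.prob, hsupp.mono fun p hp => hp.1,
      (hS_fst ▸ hmu.S.2.2 : Integrable id ((_root_.S2 pi).map Prod.fst)).comp_measurable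
        measurable_fst⟩
  refine ⟨hS.prob, hsupp, hS_fst, hS_snd, fun f hf hb =>
    martingale_of_lintegral_eq hS1 hS (fun g hg => ?_) hf hb⟩
  rw [S2_eq_reweightMap,
    lintegral_reweightMap measurable_snd measurable_inv_prod _ (by fun_prop),
    lintegral_reweightMap measurable_snd measurable_inv_prod _ (by fun_prop)]
  congr 1
  refine (h2.lintegral_weight_mul fun p => g p.1⁻¹).trans ?_
  refine (h1.lintegral_weight_mul fun p => g p.1⁻¹).symm.trans ?_
  exact (hmart (g := fun x => ENNReal.ofReal x⁻¹ * g x⁻¹) (by fun_prop)).symm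

/-- `π ↦ S(π)` is a bijection from `M(μ,ν)` onto `M(S(μ),S(ν))`. -/
theorem stmt5 (mu nu : Measure ℝ) (hmu : MemP1 mu) (hnu : MemP1 nu) :
    (∀ pi, IsMC mu nu pi → IsMC (S mu) (S nu) (S2 pi)) ∧
    (∀ pi pi', IsMC mu nu pi → IsMC mu nu pi' → S2 pi = S2 pi' → pi = pi') ∧
    (∀ rho, IsMC (S mu) (S nu) rho → ∃ pi, IsMC mu nu pi ∧ S2 pi = rho) := by
  refine ⟨fun pi h => h.S2 hmu hnu, fun pi pi' h h' heq => ?_, fun rho h => ?_⟩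
  · rw [← h.S2_S2 hnu, heq, h'.S2_S2 hnu]
  · refine ⟨S2 rho, ?_, h.S2_S2 hnu.S⟩
    simpa only [hmu.S_S, hnu.S_S] using h.S2 hmu.S hnu.S
end

section
/- Let (Ω, F, P) be a probability space with a filtration (F_t)_{t ∈ I} indexed by a linearly ordered set I with greatest element T, and let X = (X_t)_{t ∈ I} be a P-martingale with respect to (F_t) such that X_t > 0 almost surely for every t ∈ I. Define the probability measure P̂ := (X_T / E_P[X_T]) · P, i.e. the measure with density X_T / E_P[X_T] with respect to P. Then the process Y_t := 1/X_t is a P̂-martingale with respect to (F_t): each Y_t is P̂-integrable and adapted, and E_{P̂}[Y_s | F_t] = Y_t holds P̂-almost surely whenever t ≤ s in I. -/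
open MeasureTheory

/-- For a martingale `X`, the measures with densities `X s / c` and `X t / c`, for `t ≤ s`, agree on
functions measurable with respect to the information at time `t`. -/
theorem lintegral_withDensity_ofReal_martingale {Ω ι : Type*} [Preorder ι]
    {m0 : MeasurableSpace Ω} {P : Measure Ω} [IsFiniteMeasure P] {F : Filtration ι m0}
    {X : ι → Ω → ℝ} (hX : Martingale X F P) (hnonneg : ∀ t, ∀ᵐ ω ∂P, 0 ≤ X t ω)
    {c : ℝ} (hc : 0 ≤ c) {t s : ι} (hts : t ≤ s)
    {g : Ω → ENNReal} (hg : Measurable[F t] g) :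
    ∫⁻ ω, g ω ∂(P.withDensity fun ω => ENNReal.ofReal (X s ω / c)) =
      ∫⁻ ω, ENNReal.ofReal (X t ω / c) * g ω ∂P := by
  have hmeas (r : ι) : Measurable fun ω => ENNReal.ofReal (X r ω / c) :=
    (((hX.stronglyMeasurable r).mono (F.le r)).measurable.div_const c).ennreal_ofReal
  have htrim : (P.withDensity fun ω => ENNReal.ofReal (X s ω / c)).trim (F.le t) =
      (P.withDensity fun ω => ENNReal.ofReal (X t ω / c)).trim (F.le t) := by
    refine @Measure.ext _ (F t) _ _ fun A hA => ?_
    have hdens (r : ι) : ∫⁻ ω in A, ENNReal.ofReal (X r ω / c) ∂P =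
        ENNReal.ofReal ((∫ ω in A, X r ω ∂P) / c) := by
      rw [← ofReal_integral_eq_lintegral_ofReal ((hX.integrable r).div_const c).integrableOn
        (ae_restrict_of_ae ((hnonneg r).mono fun ω hω => div_nonneg hω hc)), integral_div]
    rw [trim_measurableSet_eq _ hA, trim_measurableSet_eq _ hA, withDensity_apply _ (F.le t A hA),
      withDensity_apply _ (F.le t A hA), hdens, hdens, hX.setIntegral_eq hts hA]
  rw [← lintegral_trim (F.le t) hg, htrim, lintegral_trim (F.le t) hg,
    lintegral_withDensity_eq_lintegral_mul _ (hmeas t) (hg.mono (F.le t) le_rfl)]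
  rfl

/-- if `X` is a positive `P`-martingale indexed by a linearly ordered set with
greatest element `T`, then `Y = 1/X` is a martingale under
`P̂ = (X_T / E_P[X_T]) · P`: each `Y_t` is `P̂`-integrable and `Y` is a `P̂`-martingale. -/
theorem stmt7 {Omega iota : Type*} [LinearOrder iota] {m0 : MeasurableSpace Omega}
    (P : Measure Omega) [IsProbabilityMeasure P]
    (F : Filtration iota m0) (X : iota → Omega → ℝ) (T : iota)
    (hT : ∀ t, t ≤ T)
    (hmart : Martingale X F P)
    (hint : ∀ t, Integrable (X t) P)
    (hpos : ∀ t, ∀ᵐ omega ∂P, 0 < X t omega)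
    (Phat : Measure Omega)
    (hPhat : Phat = P.withDensity fun omega =>
      ENNReal.ofReal (X T omega / ∫ w, X T w ∂P)) :
    (∀ t, Integrable (fun omega => (X t omega)⁻¹) Phat) ∧
    Martingale (fun t omega => (X t omega)⁻¹) F Phat := by
  have hmeasX (t : iota) : Measurable[F t] (X t) := (hmart.stronglyMeasurable t).measurable
  have hmeasY (t : iota) : StronglyMeasurable[F t] fun omega => (X t omega)⁻¹ :=
    (hmeasX t).inv.stronglyMeasurable
  have hc : 0 < ∫ w, X T w ∂P := by
    rw [integral_pos_iff_support_of_nonneg_ae ((hpos T).mono fun _ h => h.le) (hint T)]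
    refine pos_iff_ne_zero.2 fun h => ?_
    obtain ⟨omega, hne, hlt⟩ := ((measure_eq_zero_iff_ae_notMem.1 h).and (hpos T)).exists
    exact hne hlt.ne'
  set c := ∫ w, X T w ∂P
  have hac : Phat ≪ P := hPhat ▸ withDensity_absolutelyContinuous _ _
  have hfin : IsFiniteMeasure Phat :=
    hPhat ▸ isFiniteMeasure_withDensity_ofReal ((hint T).div_const c).2
  have hlint (t : iota) {A : Set Omega} (hA : MeasurableSet[F t] A) :
      ∫⁻ omega in A, ENNReal.ofReal (X t omega)⁻¹ ∂Phat = ENNReal.ofReal c⁻¹ * P A := by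
    rw [← lintegral_indicator (F.le t A hA), hPhat,
      lintegral_withDensity_ofReal_martingale hmart (fun t => (hpos t).mono fun _ h => h.le) hc.le
        (hT t) ((hmeasY t).measurable.ennreal_ofReal.indicator hA),
      ← lintegral_indicator_const (F.le t A hA)]
    refine lintegral_congr_ae ((hpos t).mono fun omega h => ?_)
    by_cases hmem : omega ∈ A
    · simp only [Set.indicator_of_mem hmem]
      rw [← ENNReal.ofReal_mul (by positivity)]
      congr 1
      field_simp
    · simp [Set.indicator_of_notMem hmem]
  have hnonneg (t : iota) : ∀ᵐ omega ∂Phat, 0 ≤ (X t omega)⁻¹ :=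
    hac.ae_le ((hpos t).mono fun _ h => (inv_pos.2 h).le)
  have hintY (t : iota) : Integrable (fun omega => (X t omega)⁻¹) Phat := by
    refine ⟨((hmeasY t).mono (F.le t)).aestronglyMeasurable, ?_⟩
    rw [hasFiniteIntegral_iff_ofReal (hnonneg t), ← setLIntegral_univ, hlint t MeasurableSet.univ]
    exact ENNReal.mul_lt_top ENNReal.ofReal_lt_top (measure_lt_top P _)
  have hset (t : iota) {A : Set Omega} (hA : MeasurableSet[F t] A) :
      ∫ omega in A, (X t omega)⁻¹ ∂Phat = (ENNReal.ofReal c⁻¹ * P A).toReal := by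
    rw [integral_eq_lintegral_of_nonneg_ae (ae_restrict_of_ae (hnonneg t))
      (hintY t).1.restrict, hlint t hA]
  refine ⟨hintY, hmeasY, fun t s hts => ?_⟩
  refine (ae_eq_condExp_of_forall_setIntegral_eq (F.le t) (hintY s)
    (fun A _ _ => (hintY t).integrableOn) (fun A hA _ => ?_)
    (hmeasY t).aestronglyMeasurable).symm
  rw [hset t hA, hset s (F.mono hts A hA)]
end

section
/- Let μ, ν ∈ P₁((0,∞)) with ν having finite second moment, and let π ∈ M(μ,ν) with disintegration (π_{x₀}). Then there exists a Borel probability measure Q on ℝ³, with coordinates denoted (x₀, b, x₁), such that the marginal of Q in the coordinates (x₀, b) equals the product measure μ ⊗ γ₁, the marginal of Q in the coordinates (x₀, x₁) equals π, and ∫ x₁ · b dQ(x₀, b, x₁) = ∫ MCov(π_{x₀}, γ₁) dμ(x₀). -/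
open MeasureTheory Set

open scoped Classical in
/-- Disintegration (conditional kernel) of a measure on a product space with respect to the
first coordinate; equal to `Measure.condKernel` for finite measures. -/
noncomputable def disint {α β : Type*} [MeasurableSpace α] [MeasurableSpace β]
    [StandardBorelSpace β] [Nonempty β] (rho : Measure (α × β)) : α → Measure β :=
  if h : IsFiniteMeasure rho then (letI := h; fun a => rho.condKernel a)
  else fun _ => 0


/-- The standard Gaussian measure `γ₁` (mean 0, variance 1). -/
noncomputable def gauss1 : Measure ℝ := ProbabilityTheory.gaussianReal 0 1

/-- Maximal covariance `MCov(p₁,p₂) = sup { ∫ x·y dq : q coupling of p₁ and p₂ }`. -/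
noncomputable def MCov (p1 p2 : Measure ℝ) : ℝ :=
  sSup {r | ∃ q : Measure (ℝ × ℝ), IsProbabilityMeasure q ∧
    q.map Prod.fst = p1 ∧ q.map Prod.snd = p2 ∧ r = ∫ p, p.1 * p.2 ∂q}

open ProbabilityTheory Filter Topology

/-- The quantile transform carrying `γ` to `p`: the generalized inverse of the cdf of `p`,
evaluated at the cdf of `γ`. -/
noncomputable def quantileTransform (γ p : Measure ℝ) (b : ℝ) : ℝ :=
  sInf {y | cdf γ b ≤ cdf p y}

section Cdf

variable {γ : Measure ℝ} [IsProbabilityMeasure γ]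

lemma continuous_cdf [NullSingletonClass γ] : Continuous (cdf γ) := by
  refine continuous_iff_continuousAt.2 fun x => ?_
  have h : γ {x} = 0 := measure_singleton x
  rw [← measure_cdf γ, StieltjesFunction.measure_singleton, ENNReal.ofReal_eq_zero] at h
  rw [(cdf γ).mono.continuousAt_iff_leftLim_eq_rightLim, StieltjesFunction.rightLim_eq]
  exact le_antisymm ((cdf γ).mono.leftLim_le le_rfl) (by linarith)

variable [γ.IsOpenPosMeasure]

lemma strictMono_cdf : StrictMono (cdf γ) := by
  intro a b hab
  have h : 0 < γ (Ioc a b) :=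
    (Measure.measure_Ioo_pos γ |>.2 hab).trans_le (measure_mono Ioo_subset_Ioc_self)
  rw [← measure_cdf γ, StieltjesFunction.measure_Ioc, ENNReal.ofReal_pos] at h
  linarith

lemma cdf_pos (b : ℝ) : 0 < cdf γ b :=
  (cdf_nonneg γ (b - 1)).trans_lt (strictMono_cdf (by linarith))

lemma cdf_lt_one (b : ℝ) : cdf γ b < 1 :=
  (strictMono_cdf (by linarith : b < b + 1)).trans_le (cdf_le_one γ (b + 1))

lemma measure_cdf_le [NullSingletonClass γ] {c : ℝ} (h0 : 0 ≤ c) (h1 : c ≤ 1) :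
    γ {b | cdf γ b ≤ c} = ENNReal.ofReal c := by
  rcases h0.eq_or_lt with rfl | h0
  · simp [(cdf_pos (γ := γ) _).not_ge]
  rcases h1.eq_or_lt with rfl | h1
  · simp [cdf_le_one]
  obtain ⟨x, hx⟩ := ((tendsto_cdf_atBot γ).eventually (gt_mem_nhds h0)).exists
  obtain ⟨y, hy⟩ := ((tendsto_cdf_atTop γ).eventually (lt_mem_nhds h1)).exists
  obtain ⟨z, rfl⟩ := mem_range_of_exists_le_of_exists_ge (continuous_cdf (γ := γ))
    ⟨x, hx.le⟩ ⟨y, hy.le⟩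
  simp_rw [strictMono_cdf.le_iff_le, ofReal_cdf]
  rfl

variable {p : Measure ℝ}

lemma quantileTransform_set_nonempty (b : ℝ) : {y | cdf γ b ≤ cdf p y}.Nonempty :=
  (((tendsto_cdf_atTop p).eventually (lt_mem_nhds (cdf_lt_one b))).exists).imp fun _ h => h.le

lemma quantileTransform_set_bddBelow (b : ℝ) : BddBelow {y | cdf γ b ≤ cdf p y} := by
  obtain ⟨x, hx⟩ := ((tendsto_cdf_atBot p).eventually (gt_mem_nhds (cdf_pos (γ := γ) b))).exists
  refine ⟨x, fun y hy => le_of_lt ?_⟩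
  exact (monotone_cdf p).reflect_lt (hx.trans_le hy)

lemma quantileTransform_le_iff {b y : ℝ} :
    quantileTransform γ p b ≤ y ↔ cdf γ b ≤ cdf p y := by
  refine ⟨fun h => ?_, fun h => csInf_le (quantileTransform_set_bddBelow b) h⟩
  have hc : ContinuousWithinAt (cdf p) (Ioi y) y :=
    ((cdf p).right_continuous y).mono Ioi_subset_Ici_self
  refine ge_of_tendsto hc (eventually_nhdsWithin_of_forall fun z hz => ?_)
  obtain ⟨w, hw, hwz⟩ := exists_lt_of_csInf_lt (quantileTransform_set_nonempty b)
    (lt_of_le_of_lt h hz)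
  exact hw.trans (monotone_cdf p hwz.le)

lemma monotone_quantileTransform : Monotone (quantileTransform γ p) := fun _ _ h =>
  quantileTransform_le_iff.2 ((monotone_cdf γ h).trans (quantileTransform_le_iff.1 le_rfl))

lemma map_quantileTransform [NullSingletonClass γ] [IsProbabilityMeasure p] :
    γ.map (quantileTransform γ p) = p := by
  have := Measure.isProbabilityMeasure_map (μ := γ)
    (monotone_quantileTransform (γ := γ) (p := p)).measurable.aemeasurable
  refine Measure.ext_of_Iic _ _ fun y => ?_
  rw [Measure.map_apply monotone_quantileTransform.measurable measurableSet_Iic, ← ofReal_cdf,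
    ← measure_cdf_le (γ := γ) (cdf_nonneg p y) (cdf_le_one p y)]
  congr 1
  ext b
  exact quantileTransform_le_iff

lemma measurable_quantileTransform_kernel {α : Type*} [MeasurableSpace α] (κ : Kernel α ℝ)
    [IsMarkovKernel κ] :
    Measurable fun z : α × ℝ => quantileTransform γ (κ z.1) z.2 := by
  refine measurable_of_Iic fun y => ?_
  have h : (fun z : α × ℝ => quantileTransform γ (κ z.1) z.2) ⁻¹' Iic y =
      {z | cdf γ z.2 ≤ (κ z.1).real (Iic y)} := by
    ext z
    simp [quantileTransform_le_iff, cdf_eq_real (κ z.1)]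
  rw [h]
  refine measurableSet_le ((monotone_cdf γ).measurable.comp measurable_snd) ?_
  exact ((κ.measurable_coe measurableSet_Iic).ennreal_toReal).comp measurable_fst

end Cdf

/-- Among events of given probability, the expectation of a random variable is largest on an
upper level set. -/
lemma setIntegral_snd_le_of_isUpperSet {γ : Measure ℝ} {q : Measure (ℝ × ℝ)}
    [IsProbabilityMeasure q] (hq : q.map Prod.snd = γ) (hb : Integrable id γ)
    {A : Set (ℝ × ℝ)} (hA : MeasurableSet A) {U : Set ℝ} (hU : IsUpperSet U)
    (hAU : q A = γ U) :
    ∫ z in A, z.2 ∂q ≤ ∫ b in U, b ∂γ := by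
  have hUm : MeasurableSet U := hU.ordConnected.measurableSet
  have hU' : MeasurableSet (Prod.snd ⁻¹' U : Set (ℝ × ℝ)) := measurable_snd hUm
  have hint : Integrable (fun z : ℝ × ℝ => z.2) q := by
    rw [← hq] at hb
    exact hb.comp_measurable measurable_snd
  have hqU : γ U = q (Prod.snd ⁻¹' U) := by rw [← hq, Measure.map_apply measurable_snd hUm]
  have hr : ∫ b in U, b ∂γ = ∫ z in Prod.snd ⁻¹' U, z.2 ∂q := by
    rw [← hq, setIntegral_map hUm (by fun_prop) (by fun_prop)]
  rw [hr]
  rw [hqU] at hAU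
  rcases U.eq_empty_or_nonempty with rfl | hne
  · simp only [preimage_empty, measure_empty] at hAU
    simp [Measure.restrict_eq_zero.2 hAU]
  rcases Uᶜ.eq_empty_or_nonempty with hc | ⟨d, hd⟩
  · rw [compl_empty_iff] at hc
    subst hc
    rw [preimage_univ, measure_univ] at hAU
    rw [preimage_univ, Measure.restrict_univ,
      Measure.restrict_eq_self_of_ae_mem ((prob_compl_eq_zero_iff hA).2 hAU)]
  have hbdd : BddBelow U := ⟨d, fun u hu => le_of_not_ge fun h => hd (hU h hu)⟩
  have hreal : q.real A = q.real (Prod.snd ⁻¹' U) := by simp [measureReal_def, hAU]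
  have key : ∫ z in A, (z.2 - sInf U) ∂q ≤ ∫ z in Prod.snd ⁻¹' U, (z.2 - sInf U) ∂q := by
    have hint' : Integrable (fun z : ℝ × ℝ => z.2 - sInf U) q := hint.sub (integrable_const _)
    rw [← integral_indicator hA, ← integral_indicator hU']
    refine integral_mono (hint'.indicator hA) (hint'.indicator hU') fun z => ?_
    by_cases hz : z.2 ∈ U
    · have := csInf_le hbdd hz
      by_cases hzA : z ∈ A <;> simp [indicator, hz, hzA, this]
    · have : z.2 ≤ sInf U := le_csInf hne fun u hu => le_of_not_ge fun h => hz (hU h hu)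
      by_cases hzA : z ∈ A <;> simp [indicator, hz, hzA, this]
  rw [integral_sub hint.integrableOn (integrable_const _),
    integral_sub hint.integrableOn (integrable_const _)] at key
  simpa [hreal] using key

/-- Layer-cake formula for `∫ x y dq` when `x ≥ 0` almost everywhere. -/
lemma integral_mul_eq_integral_setIntegral {q : Measure (ℝ × ℝ)} [IsFiniteMeasure q]
    (hpos : ∀ᵐ z ∂q, 0 ≤ z.1) (hint : Integrable (fun z : ℝ × ℝ => z.1 * z.2) q) :
    IntegrableOn (fun s => ∫ z in {z : ℝ × ℝ | s < z.1}, z.2 ∂q) (Ioi 0) ∧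
      ∫ z, z.1 * z.2 ∂q = ∫ s in Ioi (0 : ℝ), ∫ z in {z : ℝ × ℝ | s < z.1}, z.2 ∂q := by
  let f : (ℝ × ℝ) × ℝ → ℝ := {w | w.2 < w.1.1}.indicator fun w => w.1.2
  have hS : MeasurableSet {w : (ℝ × ℝ) × ℝ | w.2 < w.1.1} :=
    measurableSet_lt (by fun_prop) (by fun_prop)
  have hf : Measurable f := (by fun_prop : Measurable fun w : (ℝ × ℝ) × ℝ => w.1.2).indicator hS
  have hslice (z : ℝ × ℝ) : (fun s => f (z, s)) = (Iio z.1).indicator fun _ => z.2 := by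
    ext s
    simp [f, indicator]
  have hvol (z : ℝ × ℝ) (hz : 0 ≤ z.1) : (volume.restrict (Ioi (0 : ℝ))).real (Iio z.1) = z.1 := by
    rw [measureReal_restrict_apply measurableSet_Iio, inter_comm, Ioi_inter_Iio]
    simp [hz]
  have hfint : Integrable f (q.prod (volume.restrict (Ioi (0 : ℝ)))) := by
    rw [integrable_prod_iff hf.aestronglyMeasurable]
    constructor
    · refine ae_of_all _ fun z => ?_
      rw [hslice, integrable_indicator_iff measurableSet_Iio, IntegrableOn,
        Measure.restrict_restrict measurableSet_Iio, inter_comm, Ioi_inter_Iio]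
      exact integrable_const _
    · refine hint.norm.congr (hpos.mono fun z hz => ?_)
      have : (fun s => ‖f (z, s)‖) = (Iio z.1).indicator fun _ => ‖z.2‖ := by
        ext s
        rw [congrFun (hslice z) s, norm_indicator_eq_indicator_norm]
      simp only [this]
      rw [integral_indicator measurableSet_Iio, setIntegral_const, hvol z hz]
      simp [abs_of_nonneg hz]
  have houter (s : ℝ) : ∫ z, f (z, s) ∂q = ∫ z in {z : ℝ × ℝ | s < z.1}, z.2 ∂q := by
    rw [← integral_indicator (measurableSet_lt measurable_const measurable_fst)]
    rfl
  constructor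
  · have h := hfint.integral_prod_right
    simp only [houter] at h
    exact h
  · simp_rw [← houter]
    rw [← integral_integral_swap (f := fun z s => f (z, s)) hfint]
    refine integral_congr_ae (hpos.mono fun z hz => ?_)
    simp only [hslice]
    rw [integral_indicator measurableSet_Iio, setIntegral_const, hvol z hz, smul_eq_mul]

/-- A monotone transport map between laws with finite second moments, the target being
concentrated on `(0,∞)`, attains the maximal covariance. -/
lemma MCov_eq_integral_of_monotone {p γ : Measure ℝ} [IsProbabilityMeasure γ] {T : ℝ → ℝ}
    (hT : Monotone T) (hp : γ.map T = p) (hpos : ∀ᵐ x ∂p, 0 < x)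
    (hp2 : Integrable (fun x => x ^ 2) p) (hγ : MemLp id 2 γ) :
    MCov p γ = ∫ b, T b * b ∂γ := by
  have hTm : Measurable T := hT.measurable
  have hpair : Measurable fun b => (T b, b) := by fun_prop
  have hpL : MemLp id 2 p := (memLp_two_iff_integrable_sq aestronglyMeasurable_id).2 hp2
  have hmul {q : Measure (ℝ × ℝ)} (h1 : q.map Prod.fst = p) (h2 : q.map Prod.snd = γ) :
      Integrable (fun z : ℝ × ℝ => z.1 * z.2) q := by
    have hx := hpL
    have hy := hγ
    rw [← h1] at hx
    rw [← h2] at hy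
    exact (hx.comp_of_map measurable_fst.aemeasurable).integrable_mul
      (hy.comp_of_map measurable_snd.aemeasurable)
  have hae {q : Measure (ℝ × ℝ)} (h1 : q.map Prod.fst = p) : ∀ᵐ z ∂q, 0 ≤ z.1 := by
    rw [← h1] at hpos
    exact (ae_of_ae_map measurable_fst.aemeasurable hpos).mono fun z hz => hz.le
  let q₀ := γ.map fun b => (T b, b)
  have : IsProbabilityMeasure q₀ := Measure.isProbabilityMeasure_map hpair.aemeasurable
  have h1 : q₀.map Prod.fst = p := by
    rw [Measure.map_map measurable_fst hpair, ← hp]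
    rfl
  have h2 : q₀.map Prod.snd = γ := by
    rw [Measure.map_map measurable_snd hpair]
    exact Measure.map_id
  have hval : ∫ z, z.1 * z.2 ∂q₀ = ∫ b, T b * b ∂γ :=
    integral_map hpair.aemeasurable (by fun_prop)
  refine IsGreatest.csSup_eq ⟨⟨q₀, this, h1, h2, hval.symm⟩, ?_⟩
  rintro r ⟨q, hq, hq1, hq2, rfl⟩
  rw [← hval]
  obtain ⟨hi, he⟩ := integral_mul_eq_integral_setIntegral (hae hq1) (hmul hq1 hq2)
  obtain ⟨hi₀, he₀⟩ := integral_mul_eq_integral_setIntegral (hae h1) (hmul h1 h2)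
  rw [he, he₀]
  refine integral_mono hi hi₀ fun s => ?_
  have hs : MeasurableSet {z : ℝ × ℝ | s < z.1} := measurableSet_lt measurable_const measurable_fst
  have hU : IsUpperSet {b | s < T b} := fun a b hab ha => lt_of_lt_of_le ha (hT hab)
  have hqs : q {z | s < z.1} = γ {b | s < T b} := by
    have e1 : q {z | s < z.1} = p (Ioi s) := by
      rw [← hq1, Measure.map_apply measurable_fst measurableSet_Ioi]
      rfl
    rw [e1, ← hp, Measure.map_apply hTm measurableSet_Ioi]
    rfl
  calc ∫ z in {z : ℝ × ℝ | s < z.1}, z.2 ∂q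
      ≤ ∫ b in {b | s < T b}, b ∂γ :=
        setIntegral_snd_le_of_isUpperSet hq2 (hγ.integrable (by norm_num)) hs hU hqs
    _ = ∫ z in {z : ℝ × ℝ | s < z.1}, z.2 ∂q₀ :=
        (setIntegral_map (f := fun z => z.2) hs (by fun_prop) hpair.aemeasurable).symm

instance : IsProbabilityMeasure gauss1 := by unfold gauss1; infer_instance

instance : NullSingletonClass gauss1 := nullSingletonClass_gaussianReal one_ne_zero

instance : gauss1.IsOpenPosMeasure :=
  (gaussianReal_absolutelyContinuous' 0 one_ne_zero).isOpenPosMeasure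

/-- existence of a joint law `Q` of `(X₀, B₁, X₁)` with `(X₀,B₁) ∼ μ ⊗ γ₁`,
`(X₀,X₁) ∼ π` and `E[X₁ B₁] = ∫ MCov(π_{x₀}, γ₁) dμ(x₀)`. -/
theorem stmt12 (mu nu : Measure ℝ) (hmu : MemP1 mu) (hnu : MemP1 nu)
    (hmom2 : Integrable (fun x => x ^ 2) nu)
    (pi : Measure (ℝ × ℝ)) (hpi : IsMC mu nu pi) :
    ∃ Q : Measure (ℝ × ℝ × ℝ), IsProbabilityMeasure Q ∧
      Q.map (fun p => (p.1, p.2.1)) = mu.prod gauss1 ∧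
      Q.map (fun p => (p.1, p.2.2)) = pi ∧
      ∫ p, p.2.2 * p.2.1 ∂Q = ∫ x0, MCov (disint pi x0) gauss1 ∂mu := by
  obtain ⟨hprob, hsupp, hfst, hsnd, -⟩ := hpi
  have := hmu.1
  set κ := pi.condKernel with hκ
  have hdis : disint pi = fun a => κ a := by simp [disint, hκ, dif_pos]
  have hcomp : mu ⊗ₘ κ = pi := by
    rw [← hfst]
    exact pi.disintegrate κ
  let T : ℝ → ℝ → ℝ := fun x => quantileTransform gauss1 (κ x)
  have hT : Measurable fun z : ℝ × ℝ => T z.1 z.2 := measurable_quantileTransform_kernel κ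
  have hTmap (x : ℝ) : gauss1.map (T x) = κ x := map_quantileTransform
  have hG : Measurable fun z : ℝ × ℝ => (z.1, z.2, T z.1 z.2) := by fun_prop
  have hγ : MemLp id 2 gauss1 := memLp_id_gaussianReal' 2 (by norm_num)
  have hpi2 : (mu.prod gauss1).map (fun z => (z.1, T z.1 z.2)) = pi := by
    rw [← hcomp]
    ext s hs
    have hm : Measurable fun z : ℝ × ℝ => (z.1, T z.1 z.2) := by fun_prop
    rw [Measure.map_apply hm hs, Measure.prod_apply (hm hs), Measure.compProd_apply hs]
    refine lintegral_congr fun x => ?_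
    rw [← hTmap x, Measure.map_apply (by fun_prop) (measurable_prodMk_left hs)]
    rfl
  have hT2 : MemLp (fun z : ℝ × ℝ => T z.1 z.2) 2 (mu.prod gauss1) := by
    have h : (mu.prod gauss1).map (fun z => T z.1 z.2) = nu := by
      rw [← hsnd, ← hpi2, Measure.map_map measurable_snd (by fun_prop)]
      rfl
    have hn : MemLp id 2 nu := (memLp_two_iff_integrable_sq aestronglyMeasurable_id).2 hmom2
    rw [← h] at hn
    exact hn.comp_of_map hT.aemeasurable
  have hb2 : MemLp (fun z : ℝ × ℝ => z.2) 2 (mu.prod gauss1) := by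
    have h : (mu.prod gauss1).map Prod.snd = gauss1 := Measure.snd_prod
    have hn := hγ
    rw [← h] at hn
    exact hn.comp_of_map measurable_snd.aemeasurable
  have hpos : ∀ᵐ x ∂mu, ∀ᵐ y ∂κ x, 0 < y := by
    refine Measure.ae_ae_of_ae_compProd (p := fun z : ℝ × ℝ => 0 < z.2) ?_
    rw [hcomp]
    filter_upwards [compl_mem_ae_iff.2 hsupp] with z hz
    rw [compl_compl] at hz
    exact hz.2
  have hsq : ∀ᵐ x ∂mu, Integrable (fun y => y ^ 2) (κ x) := by
    have h : Integrable (fun z : ℝ × ℝ => z.2 ^ 2) pi := by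
      rw [← hsnd] at hmom2
      exact hmom2.comp_measurable measurable_snd
    rw [← hfst]
    exact h.condKernel_ae
  refine ⟨(mu.prod gauss1).map fun z => (z.1, z.2, T z.1 z.2),
    Measure.isProbabilityMeasure_map hG.aemeasurable, ?_, ?_, ?_⟩
  · rw [Measure.map_map (by fun_prop) hG]
    exact Measure.map_id
  · rw [Measure.map_map (by fun_prop) hG]
    exact hpi2
  · rw [integral_map hG.aemeasurable (by fun_prop), hdis]
    refine (integral_prod _ (hT2.integrable_mul hb2)).trans (integral_congr_ae ?_)
    filter_upwards [hpos, hsq] with x hx hx2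
    exact (MCov_eq_integral_of_monotone monotone_quantileTransform (hTmap x) hx hx2 hγ).symm
end

section
/- Let μ̂ be a Borel probability measure on (0,∞) × [0,1] with ∫ x dμ̂(x,u) < ∞ and let ν ∈ P₁((0,∞)). Then the map π ↦ Ŝ(π) is a bijection from M̂(μ̂, ν) onto M̂(Ŝ(μ̂), S(ν)). -/
open MeasureTheory Set

/-- Extended change-of-numeraire transform on measures on `(0,∞)² × [0,1]`
(coordinates `(x₀, x₁, u)`):
`Ŝ(π)(B) = (∫ x₁ · 1_B(1/x₀, 1/x₁, u) dπ) / (∫ x₁ dπ)`. -/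
noncomputable def Shat (pi : Measure (ℝ × ℝ × ℝ)) : Measure (ℝ × ℝ × ℝ) :=
  (ENNReal.ofReal (∫ p, p.2.1 ∂pi))⁻¹ •
    ((pi.withDensity fun p => ENNReal.ofReal p.2.1).map fun p => (p.1⁻¹, p.2.1⁻¹, p.2.2))

/-- Extended change-of-numeraire transform on measures on `(0,∞) × [0,1]`
(coordinates `(x, u)`): `Ŝ(μ̂)(B) = (∫ x · 1_B(1/x, u) dμ̂) / (∫ x dμ̂)`. -/
noncomputable def ShatMu (m : Measure (ℝ × ℝ)) : Measure (ℝ × ℝ) :=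
  (ENNReal.ofReal (∫ p, p.1 ∂m))⁻¹ •
    ((m.withDensity fun p => ENNReal.ofReal p.1).map fun p => (p.1⁻¹, p.2))

/-- A source: a Borel probability measure on `(0,∞) × [0,1]` with `∫ x dμ̂ < ∞`. -/
def MemSource (m : Measure (ℝ × ℝ)) : Prop :=
  IsProbabilityMeasure m ∧
  m {p : ℝ × ℝ | 0 < p.1 ∧ p.2 ∈ Set.Icc (0:ℝ) 1}ᶜ = 0 ∧
  Integrable (fun p => p.1) m

/-- A Borel probability measure on `(0,∞)² × [0,1]` with `∫ x₁ dπ < ∞`. -/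
def GoodTriple (pi : Measure (ℝ × ℝ × ℝ)) : Prop :=
  IsProbabilityMeasure pi ∧
  pi {p : ℝ × ℝ × ℝ | 0 < p.1 ∧ 0 < p.2.1 ∧ p.2.2 ∈ Set.Icc (0:ℝ) 1}ᶜ = 0 ∧
  Integrable (fun p => p.2.1) pi

/-- `π ∈ M̂`: probability measure on `(0,∞)² × [0,1]` with `∫ x₁ dπ < ∞` such that
`∫ g(x₀,u)(x₁ - x₀) dπ = 0` for all bounded Borel `g`. -/
def MemMhat (pi : Measure (ℝ × ℝ × ℝ)) : Prop :=
  GoodTriple pi ∧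
  ∀ g : ℝ × ℝ → ℝ, Measurable g → (∃ M, ∀ q, |g q| ≤ M) →
    ∫ p, g (p.1, p.2.2) * (p.2.1 - p.1) ∂pi = 0

/-- `π ∈ M̂(μ̂, ν)`: lifted martingale transport plans with source `μ̂` and
terminal marginal `ν`. -/
def MemMhatC (mhat : Measure (ℝ × ℝ)) (nu : Measure ℝ)
    (pi : Measure (ℝ × ℝ × ℝ)) : Prop :=
  MemMhat pi ∧
  pi.map (fun p => (p.1, p.2.2)) = mhat ∧
  pi.map (fun p => p.2.1) = nu

theorem lintegral_withDensity_ofReal {α : Type*} [MeasurableSpace α] (m : Measure α)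
    {w : α → ℝ} (hw : Measurable w) {f : α → ENNReal} (hf : Measurable f) :
    ∫⁻ x, f x ∂(m.withDensity fun x => ENNReal.ofReal (w x)) =
      ∫⁻ x, ENNReal.ofReal (w x) * f x ∂m :=
  lintegral_withDensity_eq_lintegral_mul m hw.ennreal_ofReal hf

/-- The measure `B ↦ (∫ w · 1_B ∘ φ dm) / (∫ w dm)`. -/
noncomputable def reweight {α : Type*} [MeasurableSpace α] (w : α → ℝ) (φ : α → α)
    (m : Measure α) : Measure α :=
  (ENNReal.ofReal (∫ x, w x ∂m))⁻¹ • ((m.withDensity fun x => ENNReal.ofReal (w x)).map φ)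

/-- `w` is an integrable positive weight for the probability measure `m`, inverted by the
measurable involution `φ`. -/
structure IsNumeraire {α : Type*} [MeasurableSpace α] (w : α → ℝ) (φ : α → α)
    (m : Measure α) : Prop where
  prob : IsProbabilityMeasure m
  measurable_weight : Measurable w
  measurable_map : Measurable φ
  involutive : ∀ x, φ (φ x) = x
  weight_map : ∀ x, w (φ x) = (w x)⁻¹
  pos : ∀ᵐ x ∂m, 0 < w x
  integrable : Integrable w m

namespace IsNumeraire

variable {α : Type*} [MeasurableSpace α] {w : α → ℝ} {φ : α → α} {m : Measure α}

theorem ofReal_integral (h : IsNumeraire w φ m) :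
    ENNReal.ofReal (∫ x, w x ∂m) = ∫⁻ x, ENNReal.ofReal (w x) ∂m :=
  ofReal_integral_eq_lintegral_ofReal h.integrable (h.pos.mono fun _ hx => hx.le)

theorem integral_pos (h : IsNumeraire w φ m) : 0 < ∫ x, w x ∂m := by
  have := h.prob
  rw [← ENNReal.ofReal_pos, h.ofReal_integral, pos_iff_ne_zero]
  intro h0
  rw [lintegral_eq_zero_iff h.measurable_weight.ennreal_ofReal] at h0
  obtain ⟨x, hx, hx'⟩ := (h.pos.and h0).exists
  exact (ENNReal.ofReal_pos.2 hx).ne' hx'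

theorem lintegral_reweight (h : IsNumeraire w φ m) {f : α → ENNReal} (hf : Measurable f) :
    ∫⁻ x, f x ∂(reweight w φ m) =
      (ENNReal.ofReal (∫ x, w x ∂m))⁻¹ * ∫⁻ x, ENNReal.ofReal (w x) * f (φ x) ∂m := by
  rw [reweight, lintegral_smul_measure, lintegral_map hf h.measurable_map,
    lintegral_withDensity_ofReal m h.measurable_weight (hf.fun_comp h.measurable_map),
    smul_eq_mul]

theorem lintegral_weight_mul_reweight (h : IsNumeraire w φ m) {f : α → ENNReal}
    (hf : Measurable f) :
    ∫⁻ x, ENNReal.ofReal (w x) * f x ∂(reweight w φ m) =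
      (ENNReal.ofReal (∫ x, w x ∂m))⁻¹ * ∫⁻ x, f (φ x) ∂m := by
  rw [h.lintegral_reweight (h.measurable_weight.ennreal_ofReal.fun_mul hf)]
  congr 1
  refine lintegral_congr_ae (h.pos.mono fun x hx => ?_)
  have h0 := (ENNReal.ofReal_pos.2 hx).ne'
  simp only [h.weight_map, ENNReal.ofReal_inv_of_pos hx]
  rw [← mul_assoc, ENNReal.mul_inv_cancel h0 ENNReal.ofReal_ne_top, one_mul]

theorem reweight_compl_eq_zero (h : IsNumeraire w φ m) {s : Set α} (hs : MeasurableSet s)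
    (hm : m sᶜ = 0) (hφ : ∀ x ∈ s, φ x ∈ s) : reweight w φ m sᶜ = 0 := by
  rw [reweight, Measure.smul_apply, Measure.map_apply h.measurable_map hs.compl]
  have : (m.withDensity fun x => ENNReal.ofReal (w x)) (φ ⁻¹' sᶜ) = 0 :=
    withDensity_absolutelyContinuous _ _
      (measure_mono_null (fun x hx hxs => hx (hφ x hxs)) hm)
  rw [this, smul_zero]

theorem reweight_pos (h : IsNumeraire w φ m) : ∀ᵐ x ∂(reweight w φ m), 0 < w x :=
  h.reweight_compl_eq_zero (measurableSet_lt measurable_const h.measurable_weight) h.pos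
    fun x hx => by simpa [h.weight_map] using hx

theorem lintegral_weight_reweight (h : IsNumeraire w φ m) :
    ∫⁻ x, ENNReal.ofReal (w x) ∂(reweight w φ m) = (ENNReal.ofReal (∫ x, w x ∂m))⁻¹ := by
  have := h.prob
  simpa using h.lintegral_weight_mul_reweight (f := fun _ => 1) measurable_const

protected theorem reweight (h : IsNumeraire w φ m) : IsNumeraire w φ (reweight w φ m) where
  prob := by
    refine ⟨?_⟩
    rw [← lintegral_one, h.lintegral_reweight measurable_const]
    simp only [mul_one]
    rw [← h.ofReal_integral]
    exact ENNReal.inv_mul_cancel (ENNReal.ofReal_pos.2 h.integral_pos).ne' ENNReal.ofReal_ne_top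
  measurable_weight := h.measurable_weight
  measurable_map := h.measurable_map
  involutive := h.involutive
  weight_map := h.weight_map
  pos := h.reweight_pos
  integrable := by
    refine ⟨h.measurable_weight.aestronglyMeasurable, ?_⟩
    rw [hasFiniteIntegral_iff_ofReal (h.reweight_pos.mono fun _ hx => hx.le), h.lintegral_weight_reweight]
    exact ENNReal.inv_lt_top.2 (ENNReal.ofReal_pos.2 h.integral_pos)

theorem reweight_reweight (h : IsNumeraire w φ m) : reweight w φ (reweight w φ m) = m := by
  refine Measure.ext_of_lintegral _ fun f hf => ?_
  rw [h.reweight.lintegral_reweight hf, h.reweight.ofReal_integral, h.lintegral_weight_reweight,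
    inv_inv, h.lintegral_weight_mul_reweight (hf.fun_comp h.measurable_map), ← mul_assoc,
    ENNReal.mul_inv_cancel (ENNReal.ofReal_pos.2 h.integral_pos).ne' ENNReal.ofReal_ne_top, one_mul]
  simp [h.involutive]

end IsNumeraire

theorem Shat_eq_reweight (pi : Measure (ℝ × ℝ × ℝ)) :
    Shat pi = reweight (fun p => p.2.1) (fun p => (p.1⁻¹, p.2.1⁻¹, p.2.2)) pi := rfl

theorem ShatMu_eq_reweight (m : Measure (ℝ × ℝ)) :
    ShatMu m = reweight (fun p => p.1) (fun p => (p.1⁻¹, p.2)) m := rfl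

theorem GoodTriple.isNumeraire {pi : Measure (ℝ × ℝ × ℝ)} (h : GoodTriple pi) :
    IsNumeraire (fun p => p.2.1) (fun p => (p.1⁻¹, p.2.1⁻¹, p.2.2)) pi where
  prob := h.1
  measurable_weight := by fun_prop
  measurable_map := by fun_prop
  involutive := by simp
  weight_map := by simp
  pos := Filter.Eventually.mono (mem_ae_iff.2 h.2.1) fun _ hp => hp.2.1
  integrable := h.2.2

theorem MemSource.isNumeraire {m : Measure (ℝ × ℝ)} (h : MemSource m) :
    IsNumeraire (fun p => p.1) (fun p => (p.1⁻¹, p.2)) m where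
  prob := h.1
  measurable_weight := by fun_prop
  measurable_map := by fun_prop
  involutive := by simp
  weight_map := by simp
  pos := Filter.Eventually.mono (mem_ae_iff.2 h.2.1) fun _ hp => hp.1
  integrable := h.2.2

theorem MemP1.isNumeraire {mu : Measure ℝ} (h : MemP1 mu) :
    IsNumeraire (fun x => x) (fun x => x⁻¹) mu where
  prob := h.1
  measurable_weight := by fun_prop
  measurable_map := by fun_prop
  involutive := by simp
  weight_map := by simp
  pos := h.2.1
  integrable := h.2.2

theorem measurableSet_strip :
    MeasurableSet {p : ℝ × ℝ | 0 < p.1 ∧ p.2 ∈ Set.Icc (0:ℝ) 1} :=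
  (measurableSet_lt measurable_const measurable_fst).inter (measurable_snd measurableSet_Icc)

theorem measurableSet_triples :
    MeasurableSet {p : ℝ × ℝ × ℝ | 0 < p.1 ∧ 0 < p.2.1 ∧ p.2.2 ∈ Set.Icc (0:ℝ) 1} :=
  (measurableSet_lt measurable_const measurable_fst).inter (measurable_snd measurableSet_strip)

theorem MemSource.shatMu {m : Measure (ℝ × ℝ)} (h : MemSource m) : MemSource (ShatMu m) := by
  refine ⟨h.isNumeraire.reweight.prob, ?_, h.isNumeraire.reweight.integrable⟩
  exact h.isNumeraire.reweight_compl_eq_zero measurableSet_strip h.2.1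
    fun x hx => ⟨inv_pos.2 hx.1, hx.2⟩

theorem GoodTriple.shat {pi : Measure (ℝ × ℝ × ℝ)} (h : GoodTriple pi) :
    GoodTriple (Shat pi) := by
  refine ⟨h.isNumeraire.reweight.prob, ?_, h.isNumeraire.reweight.integrable⟩
  exact h.isNumeraire.reweight_compl_eq_zero measurableSet_triples h.2.1
    fun x hx => ⟨inv_pos.2 hx.1, inv_pos.2 hx.2.1, hx.2.2⟩

theorem GoodTriple.fst_pos {pi : Measure (ℝ × ℝ × ℝ)} (h : GoodTriple pi) :
    ∀ᵐ p ∂pi, 0 < p.1 :=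
  Filter.Eventually.mono (mem_ae_iff.2 h.2.1) fun _ hp => hp.1

theorem integrable_fst_of_map {mhat : Measure (ℝ × ℝ)} (hmhat : MemSource mhat)
    {pi : Measure (ℝ × ℝ × ℝ)} (hmap : pi.map (fun p => (p.1, p.2.2)) = mhat) :
    Integrable (fun p => p.1) pi := by
  have h := hmhat.2.2
  rw [← hmap] at h
  exact h.comp_measurable (by fun_prop)

theorem integral_map_withDensity {α β : Type*} [MeasurableSpace α] [MeasurableSpace β]
    {m : Measure α} {w : α → ℝ} {q : α → β} {g : β → ℝ} (hw : Measurable w)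
    (hpos : ∀ᵐ x ∂m, 0 < w x) (hq : Measurable q) (hg : Measurable g) :
    ∫ y, g y ∂((m.withDensity fun x => ENNReal.ofReal (w x)).map q) =
      ∫ x, g (q x) * w x ∂m := by
  rw [integral_map hq.aemeasurable hg.aestronglyMeasurable,
    integral_withDensity_eq_integral_toReal_smul hw.ennreal_ofReal (by simp)]
  refine integral_congr_ae (hpos.mono fun x hx => ?_)
  simp [ENNReal.toReal_ofReal hx.le, mul_comm]

/-- The martingale condition tested against nonnegative, possibly unbounded, functions. -/
theorem martingale_iff_lintegral {pi : Measure (ℝ × ℝ × ℝ)} (h : GoodTriple pi)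
    (hint : Integrable (fun p => p.1) pi) :
    MemMhat pi ↔ ∀ f : ℝ × ℝ → ENNReal, Measurable f →
      ∫⁻ p, ENNReal.ofReal p.2.1 * f (p.1, p.2.2) ∂pi =
        ∫⁻ p, ENNReal.ofReal p.1 * f (p.1, p.2.2) ∂pi := by
  have hq : Measurable fun p : ℝ × ℝ × ℝ => (p.1, p.2.2) := by fun_prop
  have h0 : Measurable fun p : ℝ × ℝ × ℝ => p.1 := by fun_prop
  have h1 : Measurable fun p : ℝ × ℝ × ℝ => p.2.1 := by fun_prop
  have hlin (w : ℝ × ℝ × ℝ → ℝ) (hw : Measurable w) (f : ℝ × ℝ → ENNReal) (hf : Measurable f) :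
      ∫⁻ y, f y ∂((pi.withDensity fun p => ENNReal.ofReal (w p)).map fun p => (p.1, p.2.2)) =
        ∫⁻ p, ENNReal.ofReal (w p) * f (p.1, p.2.2) ∂pi := by
    rw [lintegral_map hf hq, lintegral_withDensity_ofReal pi hw (hf.fun_comp hq)]
  have hsub (g : ℝ × ℝ → ℝ) (hg : Measurable g) (M : ℝ) (hM : ∀ q, |g q| ≤ M) :
      ∫ p, g (p.1, p.2.2) * (p.2.1 - p.1) ∂pi =
        ∫ p, g (p.1, p.2.2) * p.2.1 ∂pi - ∫ p, g (p.1, p.2.2) * p.1 ∂pi := by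
    have hgm : AEStronglyMeasurable (fun p : ℝ × ℝ × ℝ => g (p.1, p.2.2)) pi :=
      (hg.comp hq).aestronglyMeasurable
    rw [← integral_sub]
    · simp only [mul_sub]
    · exact h.2.2.bdd_mul hgm (Filter.Eventually.of_forall fun p => hM _)
    · exact hint.bdd_mul hgm (Filter.Eventually.of_forall fun p => hM _)
  constructor
  · intro hm f hf
    rw [← hlin _ h1 f hf, ← hlin _ h0 f hf]
    congr 1
    ext s hs
    have hone : Measurable (s.indicator (fun _ => (1:ℝ))) := measurable_const.indicator hs
    have hbd : ∀ q, |s.indicator (fun _ => (1:ℝ)) q| ≤ 1 := fun q => by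
      by_cases hqs : q ∈ s <;> simp [hqs]
    have hz := hm.2 _ hone ⟨1, hbd⟩
    rw [hsub _ hone 1 hbd, sub_eq_zero, ← integral_map_withDensity h1 h.isNumeraire.pos hq hone,
      ← integral_map_withDensity h0 h.fst_pos hq hone, integral_indicator_const _ hs,
      integral_indicator_const _ hs] at hz
    have := isFiniteMeasure_withDensity_ofReal h.2.2.2
    have := isFiniteMeasure_withDensity_ofReal hint.2
    rw [← measureReal_eq_measureReal_iff]
    simpa using hz
  · refine fun hf => ⟨h, fun g hg ⟨M, hM⟩ => ?_⟩
    rw [hsub g hg M hM, sub_eq_zero, ← integral_map_withDensity h1 h.isNumeraire.pos hq hg,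
      ← integral_map_withDensity h0 h.fst_pos hq hg]
    congr 1
    refine Measure.ext_of_lintegral _ fun f hfm => ?_
    rw [hlin _ h1 f hfm, hlin _ h0 f hfm, hf f hfm]

theorem MemMhatC.shat {mhat : Measure (ℝ × ℝ)} (hmhat : MemSource mhat) {nu : Measure ℝ}
    {pi : Measure (ℝ × ℝ × ℝ)} (h : MemMhatC mhat nu pi) :
    MemMhatC (ShatMu mhat) (S nu) (Shat pi) := by
  obtain ⟨hm, hmap, hnu⟩ := h
  have hq : Measurable fun p : ℝ × ℝ × ℝ => (p.1, p.2.2) := by fun_prop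
  have hN := hm.1.isNumeraire
  have hmart := (martingale_iff_lintegral hm.1 (integrable_fst_of_map hmhat hmap)).1 hm
  have hbar : ENNReal.ofReal (∫ p, p.2.1 ∂pi) = ENNReal.ofReal (∫ q, q.1 ∂mhat) := by
    rw [hN.ofReal_integral, hmhat.isNumeraire.ofReal_integral, ← hmap,
      lintegral_map (by fun_prop) hq]
    simpa using hmart (fun _ => 1) measurable_const
  have hfst : (Shat pi).map (fun p => (p.1, p.2.2)) = ShatMu mhat := by
    refine Measure.ext_of_lintegral _ fun f hf => ?_
    rw [lintegral_map hf hq, Shat_eq_reweight, hN.lintegral_reweight (by fun_prop), hbar,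
      ShatMu_eq_reweight, hmhat.isNumeraire.lintegral_reweight hf]
    congr 1
    conv_rhs => rw [← hmap]
    rw [lintegral_map (by fun_prop) hq]
    exact hmart (fun q => f (q.1⁻¹, q.2)) (by fun_prop)
  refine ⟨(martingale_iff_lintegral hm.1.shat
    (integrable_fst_of_map hmhat.shatMu hfst)).2 fun f hf => ?_, hfst, ?_⟩
  · rw [Shat_eq_reweight, hN.lintegral_weight_mul_reweight (by fun_prop),
      hN.lintegral_reweight (by fun_prop)]
    congr 1
    refine Eq.trans ?_
      (hmart (fun q => ENNReal.ofReal q.1⁻¹ * f (q.1⁻¹, q.2)) (by fun_prop)).symm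
    refine lintegral_congr_ae (hm.1.fst_pos.mono fun p hp => ?_)
    have h0 := (ENNReal.ofReal_pos.2 hp).ne'
    simp only [ENNReal.ofReal_inv_of_pos hp]
    rw [← mul_assoc, ENNReal.mul_inv_cancel h0 ENNReal.ofReal_ne_top, one_mul]
  · have h1 : Measurable fun p : ℝ × ℝ × ℝ => p.2.1 := by fun_prop
    have hb : ∫ x, x ∂nu = ∫ p, p.2.1 ∂pi := by
      rw [← hnu, integral_map h1.aemeasurable (by fun_prop)]
    refine Measure.ext_of_lintegral _ fun f hf => ?_
    rw [lintegral_map hf h1, Shat_eq_reweight, hN.lintegral_reweight (by fun_prop), S, bary,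
      lintegral_smul_measure, lintegral_map hf measurable_inv,
      lintegral_withDensity_ofReal _ measurable_id' (by fun_prop), hb]
    rw [← hnu, lintegral_map (by fun_prop) h1]
    rfl

/-- `π ↦ Ŝ(π)` is a bijection from `M̂(μ̂,ν)` onto `M̂(Ŝ(μ̂), S(ν))`. -/
theorem stmt14 (mhat : Measure (ℝ × ℝ)) (hmhat : MemSource mhat)
    (nu : Measure ℝ) (hnu : MemP1 nu) :
    (∀ pi, MemMhatC mhat nu pi → MemMhatC (ShatMu mhat) (S nu) (Shat pi)) ∧
    (∀ pi pi', MemMhatC mhat nu pi → MemMhatC mhat nu pi' →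
      Shat pi = Shat pi' → pi = pi') ∧
    (∀ rho, MemMhatC (ShatMu mhat) (S nu) rho →
      ∃ pi, MemMhatC mhat nu pi ∧ Shat pi = rho) := by
  have shat_shat {pi} (h : GoodTriple pi) : Shat (Shat pi) = pi := h.isNumeraire.reweight_reweight
  refine ⟨fun pi h => h.shat hmhat, fun pi pi' h h' heq => ?_, fun rho h => ?_⟩
  · rw [← shat_shat h.1.1, heq, shat_shat h'.1.1]
  · refine ⟨Shat rho, ?_, shat_shat h.1.1⟩
    have hm : ShatMu (ShatMu mhat) = mhat := hmhat.isNumeraire.reweight_reweight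
    have hn : S (S nu) = nu := hnu.isNumeraire.reweight_reweight
    simpa only [hm, hn] using h.shat hmhat.shatMu
end
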